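/- For every prime number p ≥ 5, there exist no x, y ∈ ℚ_p satisfying y² = p·(x³ − p²)·((x−1)³ − p²). -/

import Mathlib

lemma aux_sub_of_lt (p : ℕ) [Fact p.Prime] (a b : ℚ_[p]) (h : ‖b‖ < ‖a‖) : ‖a - b‖ = ‖a‖ := by
  rw [sub_eq_add_neg, Padic.add_eq_max_of_ne (by rw [norm_neg]; exact h.ne'), norm_neg,
    max_eq_left h.le]

lemma aux_norm_p (p : ℕ) [hp : Fact p.Prime] :
    0 < ‖(p : ℚ_[p])‖ ∧ ‖(p : ℚ_[p])‖ < 1 :=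
  ⟨norm_pos_iff.2 (by exact_mod_cast hp.out.ne_zero), Padic.norm_p_lt_one⟩

lemma aux_big (p : ℕ) [Fact p.Prime] (t : ℚ_[p]) (h : 1 ≤ ‖t‖) :
    ‖t ^ 3 - (p : ℚ_[p]) ^ 2‖ = ‖t‖ ^ 3 := by
  obtain ⟨h0, h1⟩ := aux_norm_p p
  rw [aux_sub_of_lt, norm_pow]
  rw [norm_pow, norm_pow]
  calc _ < (1 : ℝ) := pow_lt_one₀ h0.le h1 two_ne_zero
    _ ≤ _ := one_le_pow₀ h

lemma aux_small (p : ℕ) [Fact p.Prime] (t : ℚ_[p]) (h : ‖t‖ < 1) :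
    ‖t ^ 3 - (p : ℚ_[p]) ^ 2‖ = ‖(p : ℚ_[p])‖ ^ 2 := by
  obtain ⟨h0, h1⟩ := aux_norm_p p
  have h2 : ‖t‖ ≤ ‖(p : ℚ_[p])‖ := by
    have := (Padic.norm_le_pow_iff_norm_lt_pow_add_one t (-1)).2 (by simpa using h)
    simpa using this
  rw [norm_sub_rev, aux_sub_of_lt, norm_pow]
  rw [norm_pow, norm_pow]
  calc ‖t‖ ^ 3 ≤ ‖(p : ℚ_[p])‖ ^ 3 := by gcongr
    _ < _ := pow_lt_pow_right_of_lt_one₀ h0 h1 (by norm_num)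

lemma aux_sq (p : ℕ) [hp : Fact p.Prime] (y z : ℚ_[p]) (hz : z ≠ 0)
    (h : ‖y‖ ^ 2 = ‖(p : ℚ_[p])‖ * ‖z‖ ^ 2) : False := by
  have hp0 : (p : ℝ) ≠ 0 := by exact_mod_cast hp.out.ne_zero
  have hp1 : (1 : ℝ) < p := by exact_mod_cast hp.out.one_lt
  have hy : y ≠ 0 := by
    rintro rfl
    have := (aux_norm_p p).1
    have hz' := norm_pos_iff.2 hz
    have : 0 < ‖(p : ℚ_[p])‖ * ‖z‖ ^ 2 := by positivity
    rw [← h] at this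
    simp at this
  rw [Padic.norm_eq_zpow_neg_valuation hy, Padic.norm_eq_zpow_neg_valuation hz, Padic.norm_p,
    ← zpow_neg_one, ← zpow_natCast, ← zpow_natCast, ← zpow_mul, ← zpow_mul, ← zpow_add₀ hp0] at h
  have := zpow_right_injective₀ (by linarith) hp1.ne' h
  push_cast at this
  omega

/-- Example 3.3: for a prime `p ≥ 5`, the genus 2 hyperelliptic curve
`y² = p(x³ − p²)((x−1)³ − p²)` of Namikawa–Ueno type II*−II*−α has no
affine `ℚ_p`-points. -/
theorem no_padic_points_example_three
    (p : ℕ) [Fact p.Prime] (hp5 : 5 ≤ p) :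
    ¬ ∃ x y : ℚ_[p],
      y ^ 2 = (p : ℚ_[p]) * (x ^ 3 - (p : ℚ_[p]) ^ 2) *
        ((x - 1) ^ 3 - (p : ℚ_[p]) ^ 2) := by
  rintro ⟨x, y, h⟩
  have hp0 : (p : ℚ_[p]) ≠ 0 := norm_pos_iff.1 (aux_norm_p p).1
  have h := congrArg norm h
  rw [norm_mul, norm_mul, norm_pow] at h
  rcases lt_trichotomy ‖x‖ 1 with hx | hx | hx
  · have h1 : ‖x - 1‖ = 1 := by
      rw [norm_sub_rev, aux_sub_of_lt p _ _ (by simpa using hx), norm_one]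
    rw [aux_small p x hx, aux_big p _ h1.ge, h1] at h
    exact aux_sq p y p hp0 (by rw [h]; ring)
  · rw [aux_big p x hx.ge, hx] at h
    rcases lt_or_ge ‖x - 1‖ 1 with h1 | h1
    · rw [aux_small p _ h1] at h
      exact aux_sq p y p hp0 (by rw [h]; ring)
    · have h2 : ‖x - 1‖ = 1 := by
        refine le_antisymm ?_ h1
        have := Padic.nonarchimedean x (-1)
        rw [norm_neg, norm_one, hx, max_self, ← sub_eq_add_neg] at this
        exact this
      rw [aux_big p _ h1, h2] at h
      exact aux_sq p y 1 one_ne_zero (by rw [h, norm_one]; ring)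
  · have h1 : ‖x - 1‖ = ‖x‖ := aux_sub_of_lt p _ _ (by simpa using hx)
    rw [aux_big p x hx.le, aux_big p _ (h1 ▸ hx.le), h1] at h
    refine aux_sq p y (x ^ 3) (pow_ne_zero _ ?_) (by rw [h, norm_pow]; ring)
    rintro rfl
    simp at hx
    linarith
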